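/- Let C > 0 be a real number. There is no function l : ℝ → ℝ such that for every t ∈ ℝ, l has derivative l(t)² + C at t. In other words, every solution of the Riccati equation l' = l² + C blows up in finite time and cannot be defined on all of ℝ. -/

import Mathlib

/-- Along a global solution of `l' = l ^ 2 + D ^ 2`, the angle `arctan (l / D)` grows at
constant speed `D`. -/
theorem hasDerivAt_arctan_div_of_riccati {D : ℝ} (hD : 0 < D) {l : ℝ → ℝ} {t : ℝ}
    (hl : HasDerivAt l (l t ^ 2 + D ^ 2) t) :
    HasDerivAt (fun s => Real.arctan (l s / D)) D t := by
  convert (hl.div_const D).arctan using 1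
  have h : D ^ 2 + l t ^ 2 ≠ 0 := by positivity
  field_simp
  ring

/-- Case 2 (C > 0) of Proposition 4.2: every solution of l' = l² + C blows up in finite
time, so there is no global solution on ℝ. -/
theorem riccati_pos_no_global_solution (C : ℝ) (hC : 0 < C) :
    ¬ ∃ l : ℝ → ℝ, ∀ t : ℝ, HasDerivAt l (l t ^ 2 + C) t := by
  rintro ⟨l, hl⟩
  obtain ⟨D, hD, rfl⟩ : ∃ D : ℝ, 0 < D ∧ D ^ 2 = C :=
    ⟨√C, Real.sqrt_pos.2 hC, Real.sq_sqrt hC.le⟩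
  have hg (t : ℝ) : HasDerivAt (fun s => Real.arctan (l s / D) - D * s) 0 t := by
    have h := (hasDerivAt_arctan_div_of_riccati hD (hl t)).fun_sub
      ((hasDerivAt_id t).const_mul D)
    rwa [mul_one, sub_self] at h
  have hconst := is_const_of_deriv_eq_zero (fun t => (hg t).differentiableAt)
    (fun t => (hg t).deriv) (Real.pi / D) 0
  have hπ : D * (Real.pi / D) = Real.pi := by field_simp
  linarith [Real.arctan_lt_pi_div_two (l (Real.pi / D) / D),
    Real.neg_pi_div_two_lt_arctan (l 0 / D)]
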